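/- Let u ∈ F_n^2 be a unitary, set u₂ = uφ(u) and v = u₂* u* u₂. Then the polynomial matrix equation vφ(v) u φ(v)* v* = u₂* u u₂ (equation (necU) for r = 2) holds if and only if u commutes with φ(uφ(u*)u*), i.e. φ(u)φ²(u*)φ(u*)u = uφ(u)φ²(u*)φ(u*). -/

import Mathlib

noncomputable section CuntzSetup

/-- The word `S_μ = S_{μ₁} ⋯ S_{μ_k}` associated to a multi-index `μ ∈ {1,…,n}^k`. -/
def cuntzWord {A : Type*} [Monoid A] {n k : ℕ} (S : Fin n → A) (μ : Fin k → Fin n) : A :=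
  (List.ofFn fun i => S (μ i)).prod

/-- The canonical shift `φ(x) = ∑ᵢ Sᵢ x Sᵢ*`. -/
def cuntzPhi {A : Type*} [Ring A] [StarRing A] {n : ℕ} (S : Fin n → A) (x : A) : A :=
  ∑ i, S i * x * star (S i)

/-- `u_k = u φ(u) φ²(u) ⋯ φ^{k-1}(u)`. -/
def cuntzUk {A : Type*} [Ring A] [StarRing A] {n : ℕ} (S : Fin n → A) (u : A) (k : ℕ) : A :=
  ((List.range k).map fun j => (cuntzPhi S)^[j] u).prod

/-- `F_n^k`, the linear span of `{S_μ S_ν* : |μ| = |ν| = k}`. -/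
def cuntzF {A : Type*} [Ring A] [StarRing A] [Algebra ℂ A] {n : ℕ} (S : Fin n → A) (k : ℕ) :
    Submodule ℂ A :=
  Submodule.span ℂ {x | ∃ μ ν : Fin k → Fin n, x = cuntzWord S μ * star (cuntzWord S ν)}

end CuntzSetup

/-- Isometries whose range projections sum to `1` have pairwise orthogonal ranges. -/
theorem star_mul_eq_zero_of_cuntz {A : Type*} [CStarAlgebra A] {n : ℕ} {S : Fin n → A}
    (hiso : ∀ i, star (S i) * S i = 1) (hcuntz : ∑ i, S i * star (S i) = 1)
    {i j : Fin n} (hij : i ≠ j) : star (S i) * S j = 0 := by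
  let := CStarAlgebra.spectralOrder A
  have := CStarAlgebra.spectralOrderedRing A
  have hsum : ∑ k, star (S i) * S k * star (star (S i) * S k) = 1 := by
    have h : star (S i) * (∑ k, S k * star (S k)) * S i = 1 := by
      rw [hcuntz, mul_one, hiso]
    rw [Finset.mul_sum, Finset.sum_mul] at h
    simpa only [star_mul, star_star, mul_assoc] using h
  rw [← Finset.add_sum_erase _ _ (Finset.mem_univ i), hiso, star_one, mul_one,
    add_eq_left, Finset.sum_eq_zero_iff_of_nonneg fun k _ => mul_star_self_nonneg _] at hsum
  have := hsum j (Finset.mem_erase.mpr ⟨hij.symm, Finset.mem_univ j⟩)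
  exact CStarRing.mul_star_self_eq_zero_iff _ |>.mp this

section CuntzShift

variable {A : Type*} [Ring A] [StarRing A] {n : ℕ} {S : Fin n → A}

theorem star_cuntzPhi (S : Fin n → A) (x : A) :
    star (cuntzPhi S x) = cuntzPhi S (star x) := by
  simp [cuntzPhi, star_sum, mul_assoc]

theorem cuntzPhi_one (hcuntz : ∑ i, S i * star (S i) = 1) : cuntzPhi S 1 = 1 := by
  simpa [cuntzPhi] using hcuntz

theorem cuntzPhi_mul_isometry (hiso : ∀ i, star (S i) * S i = 1)
    (horth : ∀ i j, i ≠ j → star (S i) * S j = 0) (x : A) (i : Fin n) :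
    cuntzPhi S x * S i = S i * x := by
  rw [cuntzPhi, Finset.sum_mul, Finset.sum_eq_single i]
  · rw [mul_assoc, hiso, mul_one]
  · intro j _ hj
    rw [mul_assoc, horth j i hj, mul_zero]
  · simp

theorem star_isometry_mul_cuntzPhi (hiso : ∀ i, star (S i) * S i = 1)
    (horth : ∀ i j, i ≠ j → star (S i) * S j = 0) (x : A) (i : Fin n) :
    star (S i) * cuntzPhi S x = x * star (S i) := by
  simpa [star_cuntzPhi] using congrArg star (cuntzPhi_mul_isometry hiso horth (star x) i)

theorem cuntzPhi_mul (hiso : ∀ i, star (S i) * S i = 1)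
    (horth : ∀ i j, i ≠ j → star (S i) * S j = 0) (x y : A) :
    cuntzPhi S (x * y) = cuntzPhi S x * cuntzPhi S y := by
  conv_rhs => rw [cuntzPhi, Finset.sum_mul]
  refine Finset.sum_congr rfl fun i _ => ?_
  rw [mul_assoc _ (star (S i)), star_isometry_mul_cuntzPhi hiso horth]
  simp only [mul_assoc]

theorem cuntzPhi_iterate_mul_word (hiso : ∀ i, star (S i) * S i = 1)
    (horth : ∀ i j, i ≠ j → star (S i) * S j = 0) (x : A) {k : ℕ} (μ : Fin k → Fin n) :
    (cuntzPhi S)^[k] x * cuntzWord S μ = cuntzWord S μ * x := by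
  induction k with
  | zero => simp [cuntzWord]
  | succ k ih =>
    have hμ : cuntzWord S μ = S (μ 0) * cuntzWord S (fun i => μ i.succ) := by
      simp [cuntzWord, List.ofFn_succ]
    rw [hμ, Function.iterate_succ_apply', ← mul_assoc, cuntzPhi_mul_isometry hiso horth,
      mul_assoc, ih, mul_assoc]

theorem star_cuntzPhi_iterate (S : Fin n → A) (k : ℕ) (x : A) :
    star ((cuntzPhi S)^[k] x) = (cuntzPhi S)^[k] (star x) :=
  Function.Semiconj.iterate_right (star_cuntzPhi S) k x

/-- `F_n^k` commutes with the range of `φ^k`. -/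
theorem commute_cuntzPhi_iterate_of_mem_cuntzF [Algebra ℂ A]
    (hiso : ∀ i, star (S i) * S i = 1) (horth : ∀ i j, i ≠ j → star (S i) * S j = 0)
    {k : ℕ} {a : A} (ha : a ∈ cuntzF S k) (x : A) : Commute a ((cuntzPhi S)^[k] x) := by
  induction ha using Submodule.span_induction with
  | mem a ha =>
    obtain ⟨μ, ν, rfl⟩ := ha
    have hν : star (cuntzWord S ν) * (cuntzPhi S)^[k] x = x * star (cuntzWord S ν) := by
      simpa [star_cuntzPhi_iterate] using
        congrArg star (cuntzPhi_iterate_mul_word hiso horth (star x) ν)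
    rw [Commute, SemiconjBy, mul_assoc, hν, ← mul_assoc, ← mul_assoc,
      cuntzPhi_iterate_mul_word hiso horth]
  | zero => exact Commute.zero_left _
  | add a b _ _ ha hb => exact ha.add_left hb
  | smul r a _ ha => exact ha.smul_left r

end CuntzShift

/-- The equation of `stmt11` for elements of a group, with `b`, `c` in the roles of
`φ(u)`, `φ²(u)`. -/
theorem conj_eq_iff_commute {G : Type*} [Group G] {a b c : G} (hac : Commute a c) :
    ((a * b)⁻¹ * a⁻¹ * (a * b) * ((b * c)⁻¹ * b⁻¹ * (b * c)) * a *
        ((b * c)⁻¹ * b⁻¹ * (b * c))⁻¹ * ((a * b)⁻¹ * a⁻¹ * (a * b))⁻¹ =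
      (a * b)⁻¹ * a * (a * b)) ↔
    b * c⁻¹ * b⁻¹ * a = a * b * c⁻¹ * b⁻¹ := by
  have hcac : c * a * c⁻¹ = a := by rw [← hac.eq, mul_inv_cancel_right]
  have hlhs : (a * b)⁻¹ * a⁻¹ * (a * b) * ((b * c)⁻¹ * b⁻¹ * (b * c)) * a *
        ((b * c)⁻¹ * b⁻¹ * (b * c))⁻¹ * ((a * b)⁻¹ * a⁻¹ * (a * b))⁻¹ =
      b⁻¹ * a⁻¹ * b * c⁻¹ * b⁻¹ * (c * a * c⁻¹) * b * c * b⁻¹ * a * b := by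
    group
  rw [hlhs, hcac]
  have hquot : b⁻¹ * a⁻¹ * b * c⁻¹ * b⁻¹ * a * b * c * b⁻¹ * a * b =
      (a * b)⁻¹ * (b * c⁻¹ * b⁻¹ * a * (a * b * c⁻¹ * b⁻¹)⁻¹) * a * (a * b) := by
    group
  rw [hquot, mul_left_inj, mul_left_inj, mul_eq_left, mul_inv_eq_one]

/-- for a unitary `u ∈ F_n²`, with `u₂ = uφ(u)` and
`v = u₂* u* u₂`, the equation `v φ(v) u φ(v)* v* = u₂* u u₂` holds iff
`u` commutes with `φ(uφ(u*)u*)`, i.e.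
`φ(u)φ²(u*)φ(u*)u = uφ(u)φ²(u*)φ(u*)`. -/
theorem stmt11 {A : Type*} [NormedRing A] [StarRing A] [CStarRing A]
    [CompleteSpace A] [NormedAlgebra ℂ A] [StarModule ℂ A]
    {n : ℕ} (hn : 2 ≤ n) (S : Fin n → A)
    (hiso : ∀ i, star (S i) * S i = 1)
    (hcuntz : ∑ i, S i * star (S i) = 1)
    (u : A) (huF : u ∈ cuntzF S 2) (hu : u ∈ unitary A) :
    (star (u * cuntzPhi S u) * star u * (u * cuntzPhi S u) *
          cuntzPhi S (star (u * cuntzPhi S u) * star u * (u * cuntzPhi S u)) * u *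
          star (cuntzPhi S (star (u * cuntzPhi S u) * star u * (u * cuntzPhi S u))) *
          star (star (u * cuntzPhi S u) * star u * (u * cuntzPhi S u)) =
        star (u * cuntzPhi S u) * u * (u * cuntzPhi S u)) ↔
      cuntzPhi S u * (cuntzPhi S)^[2] (star u) * cuntzPhi S (star u) * u =
        u * cuntzPhi S u * (cuntzPhi S)^[2] (star u) * cuntzPhi S (star u) := by
  have horth : ∀ i j, i ≠ j → star (S i) * S j = 0 := by
    let : CStarAlgebra A := {}
    exact fun i j hij => star_mul_eq_zero_of_cuntz hiso hcuntz hij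
  have hmul := cuntzPhi_mul hiso horth
  have hone := cuntzPhi_one hcuntz
  let φ : unitary A →* unitary A :=
    { toFun := fun w => ⟨cuntzPhi S w, by
        rw [Unitary.mem_iff, star_cuntzPhi, ← hmul, ← hmul]
        simp [hone]⟩
      map_one' := Subtype.ext hone
      map_mul' := fun w z => Subtype.ext (hmul w z) }
  let a : unitary A := ⟨u, hu⟩
  have hac : Commute a (φ (φ a)) :=
    Subtype.ext (commute_cuntzPhi_iterate_of_mem_cuntzF hiso horth huF u)
  have key := conj_eq_iff_commute (b := φ a) hac
  simp only [Subtype.ext_iff, ← Unitary.star_eq_inv, ← map_inv, ← map_mul] at key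
  simp only [Function.iterate_succ_apply, Function.iterate_zero_apply, star_cuntzPhi, ← hmul]
  exact key
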